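/- Let H ∈ (0, 1/2) and θ > 0. Define ψ(x,u) = T^{4H+1} e^{-θT(u+x)} and φ₄(x,u) = ∫_x^1 ( t^{2H-1} sgn(x+u-t)|x+u-t|^{2H-1} - (t-x)^{2H-1} sgn(u-t)|u-t|^{2H-1} ) dt. Then lim_{T → ∞} ∫_{[0,1]²} ψ(x,u) φ₄(x,u) dx du = θ^{-1-4H} ( Γ(2H)² (2H - 1/2) + Γ(2-4H) Γ(2H) Γ(4H) / Γ(1-2H) ), where Γ is the Gamma function and sgn is the sign function. -/

import Mathlib

open MeasureTheory
open Set Filter Topology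

theorem integrable_integral_of_lintegral_eq {X : Type*} [MeasurableSpace X] {μ : Measure X}
    [SFinite μ] {κ : X × ℝ → ℝ} (hm : Measurable κ) (h0 : ∀ p, 0 ≤ κ p) {c : ℝ} (hc : 0 ≤ c)
    (h : ∫⁻ x, (∫⁻ s, ENNReal.ofReal (κ (x, s))) ∂μ = ENNReal.ofReal c) :
    Integrable (fun x => ∫ s, κ (x, s)) μ ∧ ∫ x, (∫ s, κ (x, s)) ∂μ = c := by
  have e : ∫⁻ p, ENNReal.ofReal (κ p) ∂(μ.prod volume) = ENNReal.ofReal c := by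
    rw [lintegral_prod _ (by fun_prop), h]
  have hi : Integrable κ (μ.prod volume) := by
    refine ⟨hm.aestronglyMeasurable, ?_⟩
    rw [hasFiniteIntegral_iff_ofReal (ae_of_all _ h0), e]
    exact ENNReal.ofReal_lt_top
  refine ⟨hi.integral_prod_left, ?_⟩
  rw [← integral_prod _ hi, integral_eq_lintegral_of_nonneg_ae (ae_of_all _ h0)
    hm.aestronglyMeasurable, e, ENNReal.toReal_ofReal hc]

/-- The integrand of `Γ(a + 1)`, extended by zero to the whole line. -/
noncomputable def gammaKernel (a x : ℝ) : ℝ := if 0 < x then x ^ a * Real.exp (-x) else 0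

@[fun_prop]
theorem measurable_gammaKernel (a : ℝ) : Measurable (gammaKernel a) :=
  Measurable.ite measurableSet_Ioi (by fun_prop) measurable_const

theorem gammaKernel_nonneg (a x : ℝ) : 0 ≤ gammaKernel a x := by
  unfold gammaKernel
  split_ifs <;> positivity

theorem lintegral_gammaKernel {a : ℝ} (ha : -1 < a) :
    ∫⁻ x, ENNReal.ofReal (gammaKernel a x) = ENNReal.ofReal (Real.Gamma (a + 1)) := by
  have e : gammaKernel a = (Ioi 0).indicator (fun x => x ^ a * Real.exp (-x)) := by
    ext x; simp [gammaKernel, indicator]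
  have hc := Real.GammaIntegral_convergent (s := a + 1) (by linarith)
  simp only [add_sub_cancel_right] at hc
  rw [← ofReal_integral_eq_lintegral_ofReal _ (ae_of_all _ (gammaKernel_nonneg a)), e,
    integral_indicator measurableSet_Ioi, Real.Gamma_eq_integral (by linarith)]
  · simp [mul_comm]
  · rw [e, integrable_indicator_iff measurableSet_Ioi]
    exact hc.congr_fun (fun x _ => mul_comm _ _) measurableSet_Ioi

/-- The indicator function of `0 < y < s`. -/
noncomputable def wedge (y s : ℝ) : ℝ := if 0 < y ∧ y < s then 1 else 0

@[fun_prop]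
theorem measurable_wedge : Measurable (fun p : ℝ × ℝ => wedge p.1 p.2) :=
  Measurable.ite ((measurableSet_lt measurable_const measurable_fst).inter
    (measurableSet_lt measurable_fst measurable_snd)) measurable_const measurable_const

@[fun_prop]
theorem Measurable.wedge {X : Type*} [MeasurableSpace X] {f g : X → ℝ} (hf : Measurable f)
    (hg : Measurable g) : Measurable (fun x => wedge (f x) (g x)) :=
  measurable_wedge.comp (hf.prodMk hg)

theorem wedge_nonneg (y s : ℝ) : 0 ≤ wedge y s := by
  unfold wedge
  split_ifs <;> norm_num

theorem lintegral_wedge (s : ℝ) : ∫⁻ y, ENNReal.ofReal (wedge y s) = ENNReal.ofReal s := by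
  have : ∀ y, ENNReal.ofReal (wedge y s) = (Ioo 0 s).indicator 1 y := by
    intro y; unfold wedge; simp only [indicator, mem_Ioo]; split_ifs <;> simp
  simp_rw [this]
  rw [lintegral_indicator_one measurableSet_Ioo]
  simp

theorem lintegral_sub_gammaKernel {a : ℝ} (ha : -1 < a) (z : ℝ) :
    ∫⁻ x, ENNReal.ofReal (gammaKernel a (x - z)) = ENNReal.ofReal (Real.Gamma (a + 1)) := by
  rw [← lintegral_gammaKernel ha]
  exact lintegral_sub_right_eq_self (fun x => ENNReal.ofReal (gammaKernel a x)) z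

/-- The kernel whose integral over `s` is `e^{-(y+v)} ∫_y^{y+v} sᵃ (y + v - s)ᵃ ds` for `y, v > 0`.
The argument is `((y, v), s)`. -/
noncomputable def kernelA (a : ℝ) (p : (ℝ × ℝ) × ℝ) : ℝ :=
  wedge p.1.1 p.2 * gammaKernel a p.2 * gammaKernel a (p.1.2 - (p.2 - p.1.1))

/-- The kernel whose integral over `s` is `e^{-(y+v)} ∫_y^v (s - y)ᵃ (v - s)ᵃ ds` for `0 < y < v`,
and vanishes for `v ≤ y`. The argument is `((y, v), s)`. -/
noncomputable def kernelB (a : ℝ) (p : (ℝ × ℝ) × ℝ) : ℝ :=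
  (if 0 < p.1.1 then Real.exp (-(2 * p.1.1)) else 0) * gammaKernel a (p.2 - p.1.1) *
    gammaKernel a (p.1.2 - p.2)

/-- The kernel whose integral over `q` is `e^{-(y+v)} ∫_{|v-y|}^{y+v} q^{2a} dq` for `y, v > 0`.
The argument is `((y, v), q)`. -/
noncomputable def kernelD (a : ℝ) (p : (ℝ × ℝ) × ℝ) : ℝ :=
  if 0 < p.1.1 ∧ |p.2 - p.1.1| < p.1.2 ∧ p.1.2 < p.1.1 + p.2 then
    Real.exp (-(p.1.1 + p.1.2)) * p.2 ^ (2 * a) else 0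

@[fun_prop]
theorem measurable_kernelA (a : ℝ) : Measurable (kernelA a) := by
  unfold kernelA; fun_prop

theorem kernelA_nonneg (a : ℝ) (p) : 0 ≤ kernelA a p :=
  mul_nonneg (mul_nonneg (wedge_nonneg _ _) (gammaKernel_nonneg _ _)) (gammaKernel_nonneg _ _)

theorem measurable_ite_exp :
    Measurable (fun y : ℝ => if 0 < y then Real.exp (-(2 * y)) else 0) :=
  Measurable.ite measurableSet_Ioi (by fun_prop) measurable_const

@[fun_prop]
theorem measurable_kernelB (a : ℝ) : Measurable (kernelB a) := by
  unfold kernelB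
  have : Measurable (fun p : (ℝ × ℝ) × ℝ => if 0 < p.1.1 then Real.exp (-(2 * p.1.1)) else 0) :=
    measurable_ite_exp.comp (measurable_fst.comp measurable_fst)
  fun_prop

theorem kernelB_nonneg (a : ℝ) (p) : 0 ≤ kernelB a p := by
  refine mul_nonneg (mul_nonneg ?_ (gammaKernel_nonneg _ _)) (gammaKernel_nonneg _ _)
  split_ifs <;> positivity

@[fun_prop]
theorem measurable_kernelD (a : ℝ) : Measurable (kernelD a) := by
  unfold kernelD
  refine Measurable.ite (MeasurableSet.inter (s₁ := {p : (ℝ × ℝ) × ℝ | 0 < p.1.1})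
    (s₂ := {p | |p.2 - p.1.1| < p.1.2} ∩ {p | p.1.2 < p.1.1 + p.2}) ?_
    (MeasurableSet.inter ?_ ?_)) (by fun_prop) measurable_const <;>
  exact measurableSet_lt (by fun_prop) (by fun_prop)

theorem kernelD_nonneg (a : ℝ) (p) : 0 ≤ kernelD a p := by
  unfold kernelD
  split_ifs with h
  · have : 0 < p.2 := by
      have := h.2.1; have := h.2.2; rw [abs_lt] at *; linarith
    positivity
  · rfl

theorem lintegral_prod_swap_inner {κ : (ℝ × ℝ) × ℝ → ℝ} (hm : Measurable κ) :
    ∫⁻ p : ℝ × ℝ, ∫⁻ s, ENNReal.ofReal (κ (p, s)) =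
      ∫⁻ y, ∫⁻ s, ∫⁻ v, ENNReal.ofReal (κ ((y, v), s)) := by
  rw [Measure.volume_eq_prod, lintegral_prod]
  · refine lintegral_congr fun y => ?_
    rw [lintegral_lintegral_swap]
    fun_prop
  · exact (Measurable.lintegral_prod_right' (f := fun p => ENNReal.ofReal (κ p))
      (by fun_prop)).aemeasurable

theorem lintegral_kernelA {a : ℝ} (ha : -1 < a) :
    ∫⁻ p : ℝ × ℝ, ∫⁻ s, ENNReal.ofReal (kernelA a (p, s)) =
      ENNReal.ofReal (Real.Gamma (a + 1) * Real.Gamma (a + 2)) := by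
  rw [lintegral_prod_swap_inner (measurable_kernelA a)]
  have h1 : ∀ y s, ∫⁻ v, ENNReal.ofReal (kernelA a ((y, v), s)) =
      ENNReal.ofReal (gammaKernel a s) * ENNReal.ofReal (wedge y s) *
        ENNReal.ofReal (Real.Gamma (a + 1)) := by
    intro y s
    simp only [kernelA]
    simp_rw [ENNReal.ofReal_mul (mul_nonneg (wedge_nonneg _ _) (gammaKernel_nonneg _ _)),
      ENNReal.ofReal_mul (wedge_nonneg _ _)]
    rw [lintegral_const_mul _ (by fun_prop), lintegral_sub_gammaKernel ha]
    ring
  simp_rw [h1]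
  rw [lintegral_lintegral_swap (by fun_prop)]
  have h2 : ∀ s, ∫⁻ y, ENNReal.ofReal (gammaKernel a s) * ENNReal.ofReal (wedge y s) *
        ENNReal.ofReal (Real.Gamma (a + 1)) =
      ENNReal.ofReal (gammaKernel (a + 1) s) * ENNReal.ofReal (Real.Gamma (a + 1)) := by
    intro s
    rw [lintegral_mul_const _ (by fun_prop), lintegral_const_mul _ (by fun_prop), lintegral_wedge,
      ← ENNReal.ofReal_mul (gammaKernel_nonneg _ _)]
    congr 2
    unfold gammaKernel
    split_ifs with h
    · rw [Real.rpow_add_one h.ne']; ring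
    · simp
  simp_rw [h2]
  rw [lintegral_mul_const _ (by fun_prop), lintegral_gammaKernel (by linarith), mul_comm,
    ← ENNReal.ofReal_mul (Real.Gamma_nonneg_of_nonneg (by linarith))]
  norm_num [add_assoc]

theorem lintegral_ite_exp :
    ∫⁻ y : ℝ, ENNReal.ofReal (if 0 < y then Real.exp (-(2 * y)) else 0) =
      ENNReal.ofReal (1 / 2) := by
  have e : (fun y : ℝ => if 0 < y then Real.exp (-(2 * y)) else 0) =
      (Ioi 0).indicator (fun y => Real.exp (-2 * y)) := by
    ext x; simp [indicator]
  rw [← ofReal_integral_eq_lintegral_ofReal, e, integral_indicator measurableSet_Ioi,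
    integral_exp_mul_Ioi (by norm_num)]
  · norm_num
  · rw [e, integrable_indicator_iff measurableSet_Ioi]
    exact integrableOn_exp_mul_Ioi (by norm_num) 0
  · refine ae_of_all _ fun y => ?_
    dsimp; split_ifs <;> positivity

theorem lintegral_kernelB {a : ℝ} (ha : -1 < a) :
    ∫⁻ p : ℝ × ℝ, ∫⁻ s, ENNReal.ofReal (kernelB a (p, s)) =
      ENNReal.ofReal (1 / 2 * Real.Gamma (a + 1) ^ 2) := by
  have hG : 0 ≤ Real.Gamma (a + 1) := Real.Gamma_nonneg_of_nonneg (by linarith)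
  rw [lintegral_prod_swap_inner (measurable_kernelB a)]
  have h0 : ∀ y : ℝ, 0 ≤ (if 0 < y then Real.exp (-(2 * y)) else 0) := by
    intro y; split_ifs <;> positivity
  have h1 : ∀ y s, ∫⁻ v, ENNReal.ofReal (kernelB a ((y, v), s)) =
      ENNReal.ofReal (if 0 < y then Real.exp (-(2 * y)) else 0) *
        ENNReal.ofReal (gammaKernel a (s - y)) * ENNReal.ofReal (Real.Gamma (a + 1)) := by
    intro y s
    simp only [kernelB]
    simp_rw [ENNReal.ofReal_mul (mul_nonneg (h0 _) (gammaKernel_nonneg _ _)),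
      ENNReal.ofReal_mul (h0 _)]
    rw [lintegral_const_mul _ (by fun_prop), lintegral_sub_gammaKernel ha]
  simp_rw [h1]
  have h2 : ∀ y, ∫⁻ s, ENNReal.ofReal (if 0 < y then Real.exp (-(2 * y)) else 0) *
        ENNReal.ofReal (gammaKernel a (s - y)) * ENNReal.ofReal (Real.Gamma (a + 1)) =
      ENNReal.ofReal (if 0 < y then Real.exp (-(2 * y)) else 0) *
        ENNReal.ofReal (Real.Gamma (a + 1) ^ 2) := by
    intro y
    rw [lintegral_mul_const _ (by fun_prop), lintegral_const_mul _ (by fun_prop),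
      lintegral_sub_gammaKernel ha, mul_assoc, ← ENNReal.ofReal_mul hG, sq]
  simp_rw [h2]
  rw [lintegral_mul_const _ (measurable_ite_exp.ennreal_ofReal), lintegral_ite_exp,
    ← ENNReal.ofReal_mul (by norm_num)]

theorem lintegral_kernelD_inner {a y q : ℝ} (hy : 0 < y) (hq : 0 < q) :
    ∫⁻ v, ENNReal.ofReal (kernelD a ((y, v), q)) =
      ENNReal.ofReal (q ^ (2 * a)) *
        ENNReal.ofReal (Real.exp (-y) * (Real.exp (-|q - y|) - Real.exp (-(q + y)))) := by
  have hle : |q - y| ≤ q + y := by rw [abs_le]; constructor <;> linarith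
  have e : ∀ v, ENNReal.ofReal (kernelD a ((y, v), q)) =
      (Ioo |q - y| (q + y)).indicator
        (fun v => ENNReal.ofReal (q ^ (2 * a)) * ENNReal.ofReal (Real.exp (-(y + v)))) v := by
    intro v
    have : (0 < y ∧ |q - y| < v ∧ v < y + q) ↔ v ∈ Ioo |q - y| (q + y) := by
      rw [mem_Ioo, add_comm q y]; tauto
    simp only [kernelD, indicator, this]
    split_ifs
    · rw [mul_comm, ENNReal.ofReal_mul (by positivity)]
    · simp
  simp_rw [e]
  rw [lintegral_indicator measurableSet_Ioo, lintegral_const_mul _ (by fun_prop),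
    ← ofReal_integral_eq_lintegral_ofReal _ (ae_of_all _ fun v => (Real.exp_pos _).le),
    ← integral_Ioc_eq_integral_Ioo, ← intervalIntegral.integral_of_le hle]
  · congr 2
    have : ∀ v, Real.exp (-(y + v)) = Real.exp (-y) * Real.exp (-v) := by
      intro v; rw [← Real.exp_add]; ring_nf
    simp_rw [this]
    rw [intervalIntegral.integral_const_mul]
    simp
  · exact (Continuous.integrableOn_Icc (by fun_prop)).mono_set Ioo_subset_Icc_self

theorem lintegral_exp_triangle {q : ℝ} (hq : 0 < q) :
    ∫⁻ y in Ioi 0, ENNReal.ofReal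
      (Real.exp (-y) * (Real.exp (-|q - y|) - Real.exp (-(q + y)))) =
      ENNReal.ofReal (q * Real.exp (-q)) := by
  have hI : ∀ c, IntegrableOn (fun y : ℝ => Real.exp (-2 * y)) (Ioi c) := fun c =>
    integrableOn_exp_mul_Ioi (by norm_num) c
  have i1 : IntegrableOn (fun y : ℝ => (Ioc 0 q).indicator (fun _ => Real.exp (-q)) y)
      (Ioi 0) := by
    refine Integrable.integrableOn ?_
    rw [integrable_indicator_iff measurableSet_Ioc]
    simp
  have i2 : IntegrableOn (fun y : ℝ => (Ioi q).indicator
      (fun y => Real.exp q * Real.exp (-2 * y)) y) (Ioi 0) := by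
    refine Integrable.integrableOn ?_
    rw [integrable_indicator_iff measurableSet_Ioi]
    exact (hI q).const_mul _
  have i3 : IntegrableOn (fun y : ℝ => Real.exp (-q) * Real.exp (-2 * y)) (Ioi 0) :=
    (hI 0).const_mul _
  have e : ∀ y ∈ Ioi (0 : ℝ), Real.exp (-y) * (Real.exp (-|q - y|) - Real.exp (-(q + y))) =
      (Ioc 0 q).indicator (fun _ => Real.exp (-q)) y +
        (Ioi q).indicator (fun y => Real.exp q * Real.exp (-2 * y)) y -
        Real.exp (-q) * Real.exp (-2 * y) := by
    intro y hy
    rw [mem_Ioi] at hy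
    rw [mul_sub, ← Real.exp_add, ← Real.exp_add]
    rcases le_or_gt y q with h | h
    · rw [indicator_of_mem (show y ∈ Ioc 0 q from ⟨hy, h⟩),
        indicator_of_notMem (by simpa using h), abs_of_nonneg (by linarith), ← Real.exp_add]
      ring_nf
    · rw [indicator_of_notMem (by simp [h]), indicator_of_mem (by exact h),
        abs_of_neg (by linarith), ← Real.exp_add, ← Real.exp_add]
      ring_nf
  rw [← ofReal_integral_eq_lintegral_ofReal, setIntegral_congr_fun measurableSet_Ioi e]
  · congr 1
    rw [integral_sub (by exact i1.add i2) i3, integral_add i1 i2, integral_const_mul,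
      setIntegral_indicator measurableSet_Ioc, setIntegral_indicator measurableSet_Ioi,
      integral_exp_mul_Ioi (by norm_num), Ioi_inter_Ioi, max_eq_right hq.le,
      integral_const_mul, integral_exp_mul_Ioi (by norm_num),
      inter_eq_self_of_subset_right Ioc_subset_Ioi_self]
    have : Real.exp q * Real.exp (-(2 * q)) = Real.exp (-q) := by
      rw [← Real.exp_add]; ring_nf
    simp [hq.le]
    linear_combination this / 2
  · exact (integrableOn_congr_fun e measurableSet_Ioi).2 ((i1.add i2).sub i3)
  · refine (ae_restrict_mem measurableSet_Ioi).mono fun y hy => ?_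
    rw [mem_Ioi] at hy
    refine mul_nonneg (Real.exp_pos _).le (sub_nonneg.2 (Real.exp_le_exp.2 (neg_le_neg ?_)))
    rw [abs_le]; constructor <;> linarith

theorem lintegral_kernelD {a : ℝ} (ha : -1 < a) :
    ∫⁻ p : ℝ × ℝ, ∫⁻ s, ENNReal.ofReal (kernelD a (p, s)) =
      ENNReal.ofReal (Real.Gamma (2 * a + 2)) := by
  rw [lintegral_prod_swap_inner (measurable_kernelD a), lintegral_lintegral_swap]
  swap
  · have : Measurable (fun z : (ℝ × ℝ) × ℝ =>
        ENNReal.ofReal (kernelD a ((z.1.1, z.2), z.1.2))) := by fun_prop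
    exact this.lintegral_prod_right'.aemeasurable
  have h : ∀ q, ∫⁻ y, ∫⁻ v, ENNReal.ofReal (kernelD a ((y, v), q)) =
      ENNReal.ofReal (gammaKernel (2 * a + 1) q) := by
    intro q
    rcases le_or_gt q 0 with hq | hq
    · have : ∀ y v, kernelD a ((y, v), q) = 0 := by
        intro y v
        rw [kernelD, if_neg]
        rintro ⟨h1, h2, h3⟩
        dsimp only at h1 h2 h3
        rw [abs_lt] at h2
        linarith
      simp [this, gammaKernel, hq.not_gt]
    · have e : ∀ y, ∫⁻ v, ENNReal.ofReal (kernelD a ((y, v), q)) =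
          (Ioi 0).indicator (fun y => ENNReal.ofReal (q ^ (2 * a)) *
            ENNReal.ofReal (Real.exp (-y) * (Real.exp (-|q - y|) - Real.exp (-(q + y))))) y := by
        intro y
        by_cases hy : 0 < y
        · rw [indicator_of_mem (by exact hy), lintegral_kernelD_inner hy hq]
        · rw [indicator_of_notMem (by exact hy)]
          simp [kernelD, hy]
      simp_rw [e]
      rw [lintegral_indicator measurableSet_Ioi, lintegral_const_mul _ (by fun_prop),
        lintegral_exp_triangle hq, ← ENNReal.ofReal_mul (by positivity), gammaKernel, if_pos hq,
        Real.rpow_add_one hq.ne', mul_assoc]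
  simp_rw [h]
  rw [lintegral_gammaKernel (by linarith)]
  ring_nf

theorem lintegral_rpow_mul_exp_neg_mul {s r : ℝ} (hs : 0 < s) (hr : 0 < r) :
    ∫⁻ t in Ioi 0, ENNReal.ofReal (t ^ (s - 1) * Real.exp (-(r * t))) =
      ENNReal.ofReal ((1 / r) ^ s * Real.Gamma s) := by
  have e := Real.integral_rpow_mul_exp_neg_mul_Ioi hs hr
  rw [← e, ofReal_integral_eq_lintegral_ofReal]
  · refine Integrable.of_integral_ne_zero ?_
    rw [e]
    have := Real.Gamma_pos_of_pos hs
    positivity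
  · refine (ae_restrict_mem measurableSet_Ioi).mono fun t ht => ?_
    rw [mem_Ioi] at ht
    dsimp
    positivity

/-- A value of Euler's beta integral over the half-line. -/
theorem lintegral_rpow_mul_add_rpow {a q : ℝ} (ha : -1 < a) (ha' : a < 0) (hq : 0 < q) :
    ∫⁻ r in Ioi 0, ENNReal.ofReal (r ^ a * (r + q) ^ (a - 1)) =
      ENNReal.ofReal (Real.Gamma (a + 1) * Real.Gamma (-2 * a) / Real.Gamma (1 - a) *
        q ^ (2 * a)) := by
  have hG : 0 < Real.Gamma (1 - a) := Real.Gamma_pos_of_pos (by linarith)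
  have hG1 : 0 < Real.Gamma (a + 1) := Real.Gamma_pos_of_pos (by linarith)
  have e1 : ∀ r ∈ Ioi (0 : ℝ), ENNReal.ofReal (r ^ a * (r + q) ^ (a - 1)) =
      ENNReal.ofReal (Real.Gamma (1 - a))⁻¹ *
      ∫⁻ t in Ioi 0, ENNReal.ofReal (r ^ a * (t ^ (-a) * Real.exp (-((r + q) * t)))) := by
    intro r hr
    rw [mem_Ioi] at hr
    have hrq : 0 < r + q := by linarith
    simp_rw [ENNReal.ofReal_mul (Real.rpow_nonneg hr.le a)]
    have := lintegral_rpow_mul_exp_neg_mul (s := 1 - a) (by linarith) hrq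
    rw [show 1 - a - 1 = -a by ring] at this
    rw [lintegral_const_mul _ (by fun_prop), this, ← ENNReal.ofReal_mul (by positivity),
      ← ENNReal.ofReal_mul (by positivity), ← ENNReal.ofReal_mul (by positivity)]
    congr 1
    rw [one_div, Real.inv_rpow hrq.le, ← Real.rpow_neg hrq.le, neg_sub]
    field_simp
  rw [setLIntegral_congr_fun measurableSet_Ioi e1, lintegral_const_mul, lintegral_lintegral_swap]
  · have e2 : ∀ t ∈ Ioi (0 : ℝ),
        ∫⁻ r in Ioi 0, ENNReal.ofReal (r ^ a * (t ^ (-a) * Real.exp (-((r + q) * t)))) =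
        ENNReal.ofReal (Real.Gamma (a + 1)) *
          ENNReal.ofReal (t ^ (-2 * a - 1) * Real.exp (-(q * t))) := by
      intro t ht
      rw [mem_Ioi] at ht
      have e3 : ∀ r ∈ Ioi (0 : ℝ),
          ENNReal.ofReal (r ^ a * (t ^ (-a) * Real.exp (-((r + q) * t)))) =
          ENNReal.ofReal (t ^ (-a) * Real.exp (-(q * t))) *
            ENNReal.ofReal (r ^ (a + 1 - 1) * Real.exp (-(t * r))) := by
        intro r hr
        rw [← ENNReal.ofReal_mul (by positivity)]
        congr 1
        rw [add_sub_cancel_right, show -((r + q) * t) = -(q * t) + -(t * r) by ring, Real.exp_add]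
        ring
      rw [setLIntegral_congr_fun measurableSet_Ioi e3, lintegral_const_mul _ (by fun_prop),
        lintegral_rpow_mul_exp_neg_mul (by linarith) ht, ← ENNReal.ofReal_mul (by positivity),
        ← ENNReal.ofReal_mul (by positivity)]
      congr 1
      rw [one_div, Real.inv_rpow ht.le, ← Real.rpow_neg ht.le,
        show -2 * a - 1 = -a + -(a + 1) by ring, Real.rpow_add ht]
      ring
    rw [setLIntegral_congr_fun measurableSet_Ioi e2, lintegral_const_mul _ (by fun_prop),
      lintegral_rpow_mul_exp_neg_mul (by linarith) hq, ← ENNReal.ofReal_mul (by positivity),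
      ← ENNReal.ofReal_mul (by positivity)]
    congr 1
    rw [one_div, Real.inv_rpow hq.le, ← Real.rpow_neg hq.le, neg_mul, neg_neg]
    field_simp
  · fun_prop
  · exact (Measurable.lintegral_prod_right' (f := fun p : ℝ × ℝ =>
      ENNReal.ofReal (p.1 ^ a * (p.2 ^ (-a) * Real.exp (-((p.1 + q) * p.2))))) (by fun_prop))

theorem integral_rpow_mul_sub_rpow {a k m : ℝ} (ha : -1 < a) (ha' : a < 0) (hk : 0 < k)
    (hkm : k ≤ m) :
    IntegrableOn (fun r => r ^ a * ((r + k) ^ a - (r + m) ^ a)) (Ioi 0) ∧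
    ∫ r in Ioi 0, r ^ a * ((r + k) ^ a - (r + m) ^ a) =
      -a * (Real.Gamma (a + 1) * Real.Gamma (-2 * a) / Real.Gamma (1 - a)) *
        ∫ q in k..m, q ^ (2 * a) := by
  set C := Real.Gamma (a + 1) * Real.Gamma (-2 * a) / Real.Gamma (1 - a) with hC
  have hC0 : 0 ≤ C := by
    have h1 : 0 < Real.Gamma (1 - a) := Real.Gamma_pos_of_pos (by linarith)
    have h2 : 0 < Real.Gamma (a + 1) := Real.Gamma_pos_of_pos (by linarith)
    have h3 : 0 < Real.Gamma (-2 * a) := Real.Gamma_pos_of_pos (by linarith)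
    positivity
  let κ : ℝ × ℝ → ℝ := fun p => if 0 < p.1 ∧ p.2 ∈ Ioc k m then
    -a * (p.1 ^ a * (p.1 + p.2) ^ (a - 1)) else 0
  have hκ : Measurable κ := by
    refine Measurable.ite (MeasurableSet.inter (s₁ := {p : ℝ × ℝ | 0 < p.1})
      (s₂ := {p | p.2 ∈ Ioc k m}) ?_ ?_) (by fun_prop) measurable_const
    · exact measurableSet_lt (by fun_prop) (by fun_prop)
    · exact measurable_snd measurableSet_Ioc
  have hκ0 : ∀ p, 0 ≤ κ p := by
    intro p
    simp only [κ]
    split_ifs with h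
    · have h1 := h.1
      have h2 : 0 < p.2 := hk.trans h.2.1
      have : 0 ≤ -a := by linarith
      positivity
    · rfl
  have hint : IntervalIntegrable (fun q : ℝ => q ^ (2 * a)) volume k m :=
    intervalIntegral.intervalIntegrable_rpow (Or.inr (by
      rw [uIcc_of_le hkm]; exact fun h => hk.not_ge h.1))
  have hc : 0 ≤ -a * C * ∫ q in k..m, q ^ (2 * a) := by
    refine mul_nonneg (mul_nonneg (by linarith) hC0)
      (intervalIntegral.integral_nonneg hkm fun q hq => Real.rpow_nonneg (hk.le.trans hq.1) _)
  have key : ∫⁻ r in Ioi 0, ∫⁻ q, ENNReal.ofReal (κ (r, q)) =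
      ENNReal.ofReal (-a * C * ∫ q in k..m, q ^ (2 * a)) := by
    rw [lintegral_lintegral_swap (by fun_prop)]
    have e : ∀ q, ∫⁻ r in Ioi 0, ENNReal.ofReal (κ (r, q)) =
        (Ioc k m).indicator (fun q => ENNReal.ofReal (-a * C) * ENNReal.ofReal (q ^ (2 * a))) q := by
      intro q
      by_cases hq : q ∈ Ioc k m
      · have hq0 : 0 < q := hk.trans hq.1
        rw [indicator_of_mem hq, ENNReal.ofReal_mul (by linarith), mul_assoc,
          ← ENNReal.ofReal_mul hC0, hC, ← lintegral_rpow_mul_add_rpow ha ha' hq0,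
          ← lintegral_const_mul _ (by fun_prop)]
        refine setLIntegral_congr_fun measurableSet_Ioi fun r hr => ?_
        rw [mem_Ioi] at hr
        simp only [κ, if_pos (And.intro hr hq)]
        rw [ENNReal.ofReal_mul (by linarith)]
      · rw [indicator_of_notMem hq]
        simp only [κ, hq, and_false, if_false]
        simp
    simp_rw [e]
    rw [lintegral_indicator measurableSet_Ioc, lintegral_const_mul _ (by fun_prop),
      ENNReal.ofReal_mul (mul_nonneg (by linarith) hC0), intervalIntegral.integral_of_le hkm,
      ofReal_integral_eq_lintegral_ofReal]
    · exact (intervalIntegrable_iff_integrableOn_Ioc_of_le hkm).1 hint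
    · exact (ae_restrict_mem measurableSet_Ioc).mono fun q hq =>
        Real.rpow_nonneg (hk.trans hq.1).le _
  have e : ∀ r ∈ Ioi (0 : ℝ), ∫ q, κ (r, q) = r ^ a * ((r + k) ^ a - (r + m) ^ a) := by
    intro r hr
    rw [mem_Ioi] at hr
    have e1 : (fun q => κ (r, q)) = (Ioc k m).indicator
        (fun q => -a * (r ^ a * (r + q) ^ (a - 1))) := by
      ext q
      simp [κ, hr, indicator]
    rw [e1, integral_indicator measurableSet_Ioc, ← intervalIntegral.integral_of_le hkm,
      intervalIntegral.integral_const_mul, intervalIntegral.integral_const_mul,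
      intervalIntegral.integral_comp_add_left (fun x => x ^ (a - 1)), integral_rpow]
    · rw [sub_add_cancel]
      have := ha'.ne
      field_simp
      ring
    · refine Or.inr ⟨by linarith, ?_⟩
      rw [uIcc_of_le (by linarith)]
      exact fun h => by linarith [h.1]
  obtain ⟨h1, h2⟩ := integrable_integral_of_lintegral_eq hκ hκ0 hc key
  exact ⟨(integrableOn_congr_fun e measurableSet_Ioi).1 h1,
    by rw [← h2]; exact (setIntegral_congr_fun measurableSet_Ioi e).symm⟩

theorem sign_mul_abs_rpow_of_nonneg {a z : ℝ} (ha : a ≠ 0) (hz : 0 ≤ z) :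
    Real.sign z * |z| ^ a = z ^ a := by
  rcases hz.eq_or_lt with rfl | h
  · simp [Real.zero_rpow ha]
  · rw [Real.sign_of_pos h, abs_of_pos h, one_mul]

theorem sign_mul_abs_rpow_of_nonpos {a z : ℝ} (ha : a ≠ 0) (hz : z ≤ 0) :
    Real.sign z * |z| ^ a = -(-z) ^ a := by
  rcases hz.eq_or_lt with rfl | h
  · simp [Real.zero_rpow ha]
  · rw [Real.sign_of_neg h, abs_of_neg h, neg_one_mul]

theorem intervalIntegrable_rpow_mul_add_rpow {a δ b c : ℝ} (ha : -1 < a) (hδ : 0 < δ)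
    (hb : 0 ≤ b) (hc : 0 ≤ c) :
    IntervalIntegrable (fun r : ℝ => r ^ a * (r + δ) ^ a) volume b c := by
  refine (intervalIntegral.intervalIntegrable_rpow' ha).mul_continuousOn ?_
  refine ContinuousOn.rpow_const (by fun_prop) fun r hr => Or.inl ?_
  have : 0 ≤ r := le_trans (le_min hb hc) hr.1
  linarith

theorem intervalIntegrable_sub_rpow {a c y d : ℝ} (ha : -1 < a) :
    IntervalIntegrable (fun s : ℝ => (c - s) ^ a) volume y d := by
  have := (intervalIntegral.intervalIntegrable_rpow' (a := c - y) (b := c - d) ha).comp_sub_left c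
  simpa using this

theorem intervalIntegrable_rpow_mul_sub_rpow {a c y d : ℝ} (ha : -1 < a) (hy : 0 < y)
    (hd : 0 < d) :
    IntervalIntegrable (fun s : ℝ => s ^ a * (c - s) ^ a) volume y d := by
  refine (intervalIntegrable_sub_rpow ha).continuousOn_mul ?_
  refine ContinuousOn.rpow_const (by fun_prop) fun r hr => Or.inl ?_
  have : 0 < r := lt_of_lt_of_le (lt_min hy hd) hr.1
  exact this.ne'

theorem intervalIntegrable_sub_rpow_mul_sub_rpow {a y v : ℝ} (ha : -1 < a) (h : y < v) :
    IntervalIntegrable (fun s : ℝ => (s - y) ^ a * (v - s) ^ a) volume y v := by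
  have h1 := (intervalIntegral.intervalIntegrable_rpow' (a := 0) (b := (v - y) / 2)
    ha).comp_sub_right y
  have h2 := intervalIntegrable_sub_rpow (c := v) (y := (y + v) / 2) (d := v) ha
  rw [zero_add, show (v - y) / 2 + y = (y + v) / 2 by ring] at h1
  refine IntervalIntegrable.trans (b := (y + v) / 2) (h1.mul_continuousOn ?_)
    (h2.continuousOn_mul ?_)
  · refine ContinuousOn.rpow_const (by fun_prop) fun r hr => Or.inl ?_
    rw [uIcc_of_le (by linarith)] at hr
    linarith [hr.2]
  · refine ContinuousOn.rpow_const (by fun_prop) fun r hr => Or.inl ?_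
    rw [uIcc_of_le (by linarith)] at hr
    linarith [hr.1]

/-- The incomplete integral `∫₀ᴿ rᵃ (r + δ)ᵃ dr`. -/
noncomputable def partialBeta (a δ R : ℝ) : ℝ := ∫ r in 0..R, r ^ a * (r + δ) ^ a

theorem integral_sub_rpow_mul_sign_of_lt {a y v S : ℝ} (ha : -1 < a) (ha' : a < 0)
    (hv : v < y) (hS : y ≤ S) :
    IntervalIntegrable (fun s => (s - y) ^ a * Real.sign (v - s) * |v - s| ^ a) volume y S ∧
    ∫ s in y..S, (s - y) ^ a * Real.sign (v - s) * |v - s| ^ a = -partialBeta a (y - v) (S - y) := by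
  have e : ∀ s ∈ uIcc y S, (s - y) ^ a * Real.sign (v - s) * |v - s| ^ a =
      -((s - y) ^ a * (s - y + (y - v)) ^ a) := by
    intro s hs
    rw [uIcc_of_le hS] at hs
    rw [mul_assoc, sign_mul_abs_rpow_of_nonpos ha'.ne (by linarith [hs.1])]
    ring_nf
  have hi := ((intervalIntegrable_rpow_mul_add_rpow (δ := y - v) (b := 0) (c := S - y) ha
    (by linarith) le_rfl (by linarith)).comp_sub_right y).neg
  rw [zero_add, sub_add_cancel] at hi
  refine ⟨hi.congr fun s hs => (e s (uIoc_subset_uIcc hs)).symm, ?_⟩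
  rw [intervalIntegral.integral_congr e, intervalIntegral.integral_neg,
    intervalIntegral.integral_comp_sub_right (fun r => r ^ a * (r + (y - v)) ^ a), sub_self,
    partialBeta]

theorem integral_sub_rpow_mul_sign_of_gt {a y v S : ℝ} (ha : -1 < a) (ha' : a < 0)
    (hv : y < v) (hS : v ≤ S) :
    IntervalIntegrable (fun s => (s - y) ^ a * Real.sign (v - s) * |v - s| ^ a) volume y S ∧
    ∫ s in y..S, (s - y) ^ a * Real.sign (v - s) * |v - s| ^ a =
      (∫ s in y..v, (s - y) ^ a * (v - s) ^ a) - partialBeta a (v - y) (S - v) := by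
  have e1 : ∀ s ∈ uIcc y v, (s - y) ^ a * Real.sign (v - s) * |v - s| ^ a =
      (s - y) ^ a * (v - s) ^ a := by
    intro s hs
    rw [uIcc_of_le hv.le] at hs
    rw [mul_assoc, sign_mul_abs_rpow_of_nonneg ha'.ne (by linarith [hs.2])]
  have e2 : ∀ s ∈ uIcc v S, (s - y) ^ a * Real.sign (v - s) * |v - s| ^ a =
      -((s - v) ^ a * (s - v + (v - y)) ^ a) := by
    intro s hs
    rw [uIcc_of_le hS] at hs
    rw [mul_assoc, sign_mul_abs_rpow_of_nonpos ha'.ne (by linarith [hs.1])]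
    ring_nf
  have i1 := (intervalIntegrable_sub_rpow_mul_sub_rpow ha hv).congr
    fun s hs => (e1 s (uIoc_subset_uIcc hs)).symm
  have hi := ((intervalIntegrable_rpow_mul_add_rpow (δ := v - y) (b := 0) (c := S - v) ha
    (by linarith) le_rfl (by linarith)).comp_sub_right v).neg
  rw [zero_add, sub_add_cancel] at hi
  have i2 := hi.congr fun s hs => (e2 s (uIoc_subset_uIcc hs)).symm
  refine ⟨i1.trans i2, ?_⟩
  rw [← intervalIntegral.integral_add_adjacent_intervals i1 i2,
    intervalIntegral.integral_congr e1, intervalIntegral.integral_congr e2,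
    intervalIntegral.integral_neg,
    intervalIntegral.integral_comp_sub_right (fun r => r ^ a * (r + (v - y)) ^ a), sub_self,
    partialBeta]
  ring

theorem integral_sub_rpow_mul_sign {a y v S : ℝ} (ha : -1 < a) (ha' : a < 0)
    (hne : y ≠ v)
    (hy : y ≤ S) (hv : v ≤ S) :
    IntervalIntegrable (fun s => (s - y) ^ a * Real.sign (v - s) * |v - s| ^ a) volume y S ∧
    ∫ s in y..S, (s - y) ^ a * Real.sign (v - s) * |v - s| ^ a =
      (∫ s in y..max y v, (s - y) ^ a * (v - s) ^ a) -
        partialBeta a |v - y| (S - max y v) := by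
  rcases hne.lt_or_gt with h | h
  · rw [max_eq_right h.le, abs_of_pos (by linarith)]
    exact integral_sub_rpow_mul_sign_of_gt ha ha' h hv
  · rw [max_eq_left h.le, abs_of_neg (by linarith), neg_sub, intervalIntegral.integral_same,
      zero_sub]
    exact integral_sub_rpow_mul_sign_of_lt ha ha' h hy

theorem integral_rpow_mul_sign_of_le {a y c d : ℝ} (ha : -1 < a) (ha' : a < 0)
    (hy : 0 < y) (hd : y ≤ d)
    (hc : d ≤ c) :
    IntervalIntegrable (fun s => s ^ a * Real.sign (c - s) * |c - s| ^ a) volume y d ∧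
    ∫ s in y..d, s ^ a * Real.sign (c - s) * |c - s| ^ a = ∫ s in y..d, s ^ a * (c - s) ^ a := by
  have e : ∀ s ∈ uIcc y d, s ^ a * Real.sign (c - s) * |c - s| ^ a = s ^ a * (c - s) ^ a := by
    intro s hs
    rw [uIcc_of_le hd] at hs
    rw [mul_assoc, sign_mul_abs_rpow_of_nonneg ha'.ne (by linarith [hs.2])]
  exact ⟨(intervalIntegrable_rpow_mul_sub_rpow ha hy (by linarith)).congr
    fun s hs => (e s (uIoc_subset_uIcc hs)).symm, intervalIntegral.integral_congr e⟩

theorem integral_rpow_mul_sign {a y c S : ℝ} (ha : -1 < a) (ha' : a < 0)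
    (hy : 0 < y) (hc : y ≤ c)
    (hS : c ≤ S) :
    IntervalIntegrable (fun s => s ^ a * Real.sign (c - s) * |c - s| ^ a) volume y S ∧
    ∫ s in y..S, s ^ a * Real.sign (c - s) * |c - s| ^ a =
      (∫ s in y..c, s ^ a * (c - s) ^ a) - partialBeta a c (S - c) := by
  obtain ⟨i1, e1⟩ := integral_rpow_mul_sign_of_le ha ha' hy hc le_rfl
  have e2 : ∀ s ∈ uIcc c S, s ^ a * Real.sign (c - s) * |c - s| ^ a =
      -((s - c) ^ a * (s - c + c) ^ a) := by
    intro s hs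
    rw [uIcc_of_le hS] at hs
    rw [mul_assoc, sign_mul_abs_rpow_of_nonpos ha'.ne (by linarith [hs.1])]
    ring_nf
  have hi := ((intervalIntegrable_rpow_mul_add_rpow (δ := c) (b := 0) (c := S - c) ha
    (by linarith) le_rfl (by linarith)).comp_sub_right c).neg
  rw [zero_add, sub_add_cancel] at hi
  have i2 := hi.congr fun s hs => (e2 s (uIoc_subset_uIcc hs)).symm
  refine ⟨i1.trans i2, ?_⟩
  rw [← intervalIntegral.integral_add_adjacent_intervals i1 i2, e1,
    intervalIntegral.integral_congr e2, intervalIntegral.integral_neg,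
    intervalIntegral.integral_comp_sub_right (fun r => r ^ a * (r + c) ^ a), sub_self,
    partialBeta]
  ring

/-- The integrand defining `φ₄`. -/
noncomputable def phiIntegrand (a y v s : ℝ) : ℝ :=
  s ^ a * Real.sign (y + v - s) * |y + v - s| ^ a -
    (s - y) ^ a * Real.sign (v - s) * |v - s| ^ a

theorem integral_phiIntegrand_of_le {a y v S : ℝ} (ha : -1 < a) (ha' : a < 0) (hy : 0 < y)
    (hv : 0 < v) (hne : y ≠ v) (hS : y + v ≤ S) :
    ∫ s in y..S, phiIntegrand a y v s =
      (∫ s in y..(y + v), s ^ a * (y + v - s) ^ a) -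
        (∫ s in y..max y v, (s - y) ^ a * (v - s) ^ a) +
        (∫ r in 0..(S - (y + v)), r ^ a * ((r + |v - y|) ^ a - (r + (y + v)) ^ a)) +
        ∫ r in (S - (y + v))..(S - max y v), r ^ a * (r + |v - y|) ^ a := by
  obtain ⟨i1, e1⟩ := integral_rpow_mul_sign ha ha' hy (show y ≤ y + v by linarith) hS
  obtain ⟨i2, e2⟩ := integral_sub_rpow_mul_sign (S := S) ha ha' hne (by linarith) (by linarith)
  have hk : 0 < |v - y| := abs_pos.2 (sub_ne_zero.2 hne.symm)
  have hmax : max y v ≤ S := max_le (by linarith) (by linarith)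
  have j1 := intervalIntegrable_rpow_mul_add_rpow (b := 0) (c := S - (y + v)) ha hk le_rfl
    (by linarith)
  have j2 := intervalIntegrable_rpow_mul_add_rpow (b := S - (y + v)) (c := S - max y v) ha hk
    (by linarith) (by linarith)
  have j3 := intervalIntegrable_rpow_mul_add_rpow (b := 0) (c := S - (y + v)) ha
    (show 0 < y + v by linarith) le_rfl (by linarith)
  simp only [phiIntegrand]
  rw [intervalIntegral.integral_sub i1 i2, e1, e2, partialBeta, partialBeta,
    ← intervalIntegral.integral_add_adjacent_intervals j1 j2]
  simp_rw [mul_sub]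
  rw [intervalIntegral.integral_sub j1 j3]
  ring

theorem integral_phiIntegrand_of_ge {a y v S : ℝ} (ha : -1 < a) (ha' : a < 0) (hy : 0 < y)
    (hne : y ≠ v) (hyS : y ≤ S) (hvS : v ≤ S) (hS : S ≤ y + v) :
    ∫ s in y..S, phiIntegrand a y v s =
      (∫ s in y..S, s ^ a * (y + v - s) ^ a) -
        (∫ s in y..max y v, (s - y) ^ a * (v - s) ^ a) +
        ∫ r in 0..(S - max y v), r ^ a * (r + |v - y|) ^ a := by
  obtain ⟨i1, e1⟩ := integral_rpow_mul_sign_of_le ha ha' hy hyS hS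
  obtain ⟨i2, e2⟩ := integral_sub_rpow_mul_sign (S := S) ha ha' hne hyS hvS
  simp only [phiIntegrand]
  rw [intervalIntegral.integral_sub i1 i2, e1, e2, partialBeta]
  ring

theorem integral_rpow_mul_add_rpow_le {a k R R' : ℝ} (ha : -1 < a) (ha' : a < 0) (hk : 0 < k)
    (hR : 0 ≤ R) (hRR : R ≤ R') :
    ∫ r in R..R', r ^ a * (r + k) ^ a ≤ k ^ a * ((R' - R) ^ (a + 1) / (a + 1)) := by
  have h : ∫ r in R..R', (r - R) ^ a * k ^ a = k ^ a * ((R' - R) ^ (a + 1) / (a + 1)) := by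
    rw [intervalIntegral.integral_mul_const,
      intervalIntegral.integral_comp_sub_right (fun r => r ^ a), integral_rpow (Or.inl ha),
      sub_self, Real.zero_rpow (by linarith)]
    ring
  rw [← h]
  have hi := ((intervalIntegral.intervalIntegrable_rpow' (a := 0) (b := R' - R)
    ha).comp_sub_right R).mul_const (k ^ a)
  rw [zero_add, sub_add_cancel] at hi
  refine intervalIntegral.integral_mono_on_of_le_Ioo hRR
    (intervalIntegrable_rpow_mul_add_rpow ha hk hR (hR.trans hRR)) hi fun r hr => ?_
  have h1 : 0 < r - R := by linarith [hr.1]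
  have h2 : 0 < r := by linarith
  exact mul_le_mul (Real.rpow_le_rpow_of_nonpos h1 (by linarith) ha'.le)
    (Real.rpow_le_rpow_of_nonpos hk (by linarith) ha'.le) (by positivity) (by positivity)

theorem integral_rpow_mul_add_rpow_nonneg {a k R R' : ℝ} (hk : 0 < k)
    (hR : 0 ≤ R) (hRR : R ≤ R') : 0 ≤ ∫ r in R..R', r ^ a * (r + k) ^ a := by
  refine intervalIntegral.integral_nonneg hRR fun r hr => ?_
  have : 0 ≤ r := hR.trans hr.1
  positivity

theorem integral_sub_rpow_nonneg {a y v : ℝ} :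
    0 ≤ ∫ s in y..max y v, (s - y) ^ a * (v - s) ^ a := by
  refine intervalIntegral.integral_nonneg (le_max_left _ _) fun s hs => ?_
  rcases le_total y v with h | h
  · rw [max_eq_right h] at hs
    exact mul_nonneg (Real.rpow_nonneg (by linarith [hs.1]) _)
      (Real.rpow_nonneg (by linarith [hs.2]) _)
  · rw [max_eq_left h] at hs
    obtain rfl : s = y := le_antisymm hs.2 hs.1
    rcases eq_or_ne a 0 with rfl | ha
    · simp
    · simp [Real.zero_rpow ha]

theorem abs_integral_phiIntegrand_le {a y v S : ℝ} (ha : -1 < a) (ha' : a < 0) (hy : 0 < y)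
    (hv : 0 < v) (hne : y ≠ v) (hyS : y ≤ S) (hvS : v ≤ S) :
    |∫ s in y..S, phiIntegrand a y v s| ≤
      (∫ s in y..(y + v), s ^ a * (y + v - s) ^ a) +
        (∫ s in y..max y v, (s - y) ^ a * (v - s) ^ a) +
        (∫ r in Ioi 0, r ^ a * ((r + |v - y|) ^ a - (r + (y + v)) ^ a)) +
        |v - y| ^ a * (y ^ (a + 1) / (a + 1)) := by
  have hk : 0 < |v - y| := abs_pos.2 (sub_ne_zero.2 hne.symm)
  have hkm : |v - y| ≤ y + v := by rw [abs_le]; constructor <;> linarith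
  have ha1 : 0 < a + 1 := by linarith
  have hB := integral_sub_rpow_nonneg (a := a) (y := y) (v := v)
  have hD0 : ∀ r ∈ Ioi (0 : ℝ), 0 ≤ r ^ a * ((r + |v - y|) ^ a - (r + (y + v)) ^ a) := by
    intro r hr
    rw [mem_Ioi] at hr
    refine mul_nonneg (by positivity) (sub_nonneg.2 ?_)
    exact Real.rpow_le_rpow_of_nonpos (by linarith) (by linarith) ha'.le
  have hD := setIntegral_nonneg (μ := volume) measurableSet_Ioi hD0
  have hmin : y + v - max y v = min y v := by linarith [max_add_min y v]
  have hE : ∀ z, 0 ≤ z → z ≤ min y v → |v - y| ^ a * (z ^ (a + 1) / (a + 1)) ≤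
      |v - y| ^ a * (y ^ (a + 1) / (a + 1)) := by
    intro z hz hzy
    have := Real.rpow_le_rpow hz (hzy.trans (min_le_left y v)) ha1.le
    gcongr
  have hmax : max y v ≤ S := max_le hyS hvS
  have hA0 : ∀ d, d ≤ y + v → ∀ s ∈ Icc y d, 0 ≤ s ^ a * (y + v - s) ^ a := by
    intro d hd s hs
    exact mul_nonneg (Real.rpow_nonneg (by linarith [hs.1]) _)
      (Real.rpow_nonneg (by linarith [hs.2]) _)
  rcases le_total (y + v) S with h | h
  · rw [integral_phiIntegrand_of_le ha ha' hy hv hne h]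
    have hA := intervalIntegral.integral_nonneg (μ := volume) (by linarith) (hA0 _ le_rfl)
    have hI := (integral_rpow_mul_sub_rpow ha ha' hk hkm).1
    have hJ : ∫ r in 0..(S - (y + v)), r ^ a * ((r + |v - y|) ^ a - (r + (y + v)) ^ a) ≤
        ∫ r in Ioi 0, r ^ a * ((r + |v - y|) ^ a - (r + (y + v)) ^ a) := by
      rw [intervalIntegral.integral_of_le (by linarith)]
      exact setIntegral_mono_set hI ((ae_restrict_mem measurableSet_Ioi).mono hD0)
        Ioc_subset_Ioi_self.eventuallyLE
    have hJ0 : 0 ≤ ∫ r in 0..(S - (y + v)), r ^ a * ((r + |v - y|) ^ a - (r + (y + v)) ^ a) := by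
      rw [intervalIntegral.integral_of_le (by linarith)]
      exact setIntegral_nonneg measurableSet_Ioc fun r hr => hD0 r hr.1
    have hmm : S - (y + v) ≤ S - max y v := by linarith [lt_min hy hv]
    have hL0 := integral_rpow_mul_add_rpow_nonneg (a := a) hk (sub_nonneg.2 h) hmm
    have hL := integral_rpow_mul_add_rpow_le ha ha' hk (sub_nonneg.2 h) hmm
    rw [show S - max y v - (S - (y + v)) = min y v by linarith] at hL
    have := hE _ (lt_min hy hv).le le_rfl
    rw [abs_le]
    constructor <;> linarith
  · rw [integral_phiIntegrand_of_ge ha ha' hy hne hyS hvS h]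
    have hA := intervalIntegral.integral_nonneg (μ := volume) hyS (hA0 _ h)
    have hA' : ∫ s in y..S, s ^ a * (y + v - s) ^ a ≤
        ∫ s in y..(y + v), s ^ a * (y + v - s) ^ a := by
      refine intervalIntegral.integral_mono_interval le_rfl hyS h
        ((ae_restrict_mem measurableSet_Ioc).mono fun s hs => hA0 _ le_rfl s (Ioc_subset_Icc_self hs))
        (intervalIntegrable_rpow_mul_sub_rpow ha hy (by linarith))
    have hL0 := integral_rpow_mul_add_rpow_nonneg (a := a) hk le_rfl (sub_nonneg.2 hmax)
    have hL := integral_rpow_mul_add_rpow_le ha ha' hk le_rfl (sub_nonneg.2 hmax)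
    rw [sub_zero] at hL
    have := hE (S - max y v) (by linarith) (by linarith)
    rw [abs_le]
    constructor <;> linarith

theorem tendsto_integral_phiIntegrand {a y v : ℝ} (ha : -1 < a) (ha' : a < 0) (hy : 0 < y)
    (hv : 0 < v) (hne : y ≠ v) :
    Tendsto (fun S => ∫ s in y..S, phiIntegrand a y v s) atTop
      (𝓝 ((∫ s in y..(y + v), s ^ a * (y + v - s) ^ a) -
        (∫ s in y..max y v, (s - y) ^ a * (v - s) ^ a) +
        ∫ r in Ioi 0, r ^ a * ((r + |v - y|) ^ a - (r + (y + v)) ^ a))) := by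
  have hk : 0 < |v - y| := abs_pos.2 (sub_ne_zero.2 hne.symm)
  have hkm : |v - y| ≤ y + v := by rw [abs_le]; constructor <;> linarith
  have hI := (integral_rpow_mul_sub_rpow ha ha' hk hkm).1
  have hmin : y + v - max y v = min y v := by linarith [max_add_min y v]
  have hm := lt_min hy hv
  have t1 := intervalIntegral_tendsto_integral_Ioi 0 hI
    (tendsto_atTop_add_const_right atTop (-(y + v)) tendsto_id)
  have t2 : Tendsto (fun S => ∫ r in (S - (y + v))..(S - max y v), r ^ a * (r + |v - y|) ^ a)
      atTop (𝓝 0) := by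
    have t3 : Tendsto (fun S : ℝ => (S + -(y + v)) ^ a * |v - y| ^ a * min y v) atTop (𝓝 0) := by
      have := (tendsto_rpow_neg_atTop (y := -a) (by linarith)).comp
        (tendsto_atTop_add_const_right atTop (-(y + v)) tendsto_id)
      have := (this.mul_const (|v - y| ^ a)).mul_const (min y v)
      simpa using this
    refine squeeze_zero' ?_ ?_ t3
    · filter_upwards [eventually_ge_atTop (y + v)] with S hS
      exact integral_rpow_mul_add_rpow_nonneg hk (sub_nonneg.2 hS) (by linarith)
    · filter_upwards [eventually_gt_atTop (y + v)] with S hS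
      have hle : S - (y + v) ≤ S - max y v := by linarith
      calc _ ≤ ∫ r in (S - (y + v))..(S - max y v), (S + -(y + v)) ^ a * |v - y| ^ a := by
            refine intervalIntegral.integral_mono_on hle
              (intervalIntegrable_rpow_mul_add_rpow ha hk (by linarith) (by linarith))
              intervalIntegrable_const fun r hr => ?_
            have h1 : 0 < S + -(y + v) := by linarith
            have h2 : S + -(y + v) ≤ r := by linarith [hr.1]
            have h3 : 0 < r := by linarith
            exact mul_le_mul (Real.rpow_le_rpow_of_nonpos h1 h2 ha'.le)
              (Real.rpow_le_rpow_of_nonpos hk (by linarith) ha'.le) (by positivity)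
              (by positivity)
        _ = _ := by
            rw [intervalIntegral.integral_const, smul_eq_mul,
              show S - max y v - (S - (y + v)) = min y v by linarith, mul_comm]
  have t := (t1.const_add ((∫ s in y..(y + v), s ^ a * (y + v - s) ^ a) -
        (∫ s in y..max y v, (s - y) ^ a * (v - s) ^ a))).add t2
  rw [add_zero] at t
  refine t.congr' ?_
  filter_upwards [eventually_ge_atTop (y + v)] with S hS
  rw [integral_phiIntegrand_of_le ha ha' hy hv hne hS]
  simp [sub_eq_add_neg]

theorem kernelA_eq_zero {a y v s : ℝ} (h : ¬(0 < y ∧ 0 < v)) : kernelA a ((y, v), s) = 0 := by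
  simp only [kernelA, wedge, gammaKernel]
  split_ifs with h1 h2 h3 <;> simp
  exact absurd ⟨h1.1, by linarith⟩ h

theorem kernelB_eq_zero {a y v s : ℝ} (h : ¬(0 < y ∧ 0 < v)) : kernelB a ((y, v), s) = 0 := by
  simp only [kernelB, gammaKernel]
  split_ifs with h1 h2 h3 <;> simp
  exact absurd ⟨h1, by linarith⟩ h

theorem kernelD_eq_zero {a y v s : ℝ} (h : ¬(0 < y ∧ 0 < v)) : kernelD a ((y, v), s) = 0 := by
  rw [kernelD, if_neg]
  rintro ⟨h1, h2, -⟩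
  exact h ⟨h1, (abs_nonneg _).trans_lt h2⟩

theorem integral_ite_Ioo {y z : ℝ} (h : y ≤ z) {f g : ℝ → ℝ} (c : ℝ)
    (hin : ∀ s ∈ Ioo y z, f s = c * g s) (hout : ∀ s ∉ Ioo y z, f s = 0) :
    ∫ s, f s = c * ∫ s in y..z, g s := by
  have : f = (Ioo y z).indicator fun s => c * g s := by
    ext s
    by_cases hs : s ∈ Ioo y z
    · rw [indicator_of_mem hs, hin s hs]
    · rw [indicator_of_notMem hs, hout s hs]
  rw [this, integral_indicator measurableSet_Ioo, ← integral_Ioc_eq_integral_Ioo,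
    ← intervalIntegral.integral_of_le h, intervalIntegral.integral_const_mul]

theorem integral_kernelA {a y v : ℝ} (hy : 0 < y) (hv : 0 < v) :
    ∫ s, kernelA a ((y, v), s) =
      Real.exp (-(y + v)) * ∫ s in y..(y + v), s ^ a * (y + v - s) ^ a := by
  refine integral_ite_Ioo (by linarith) _ (fun s hs => ?_) fun s hs => ?_
  · have h1 : 0 < s := hy.trans hs.1
    have h2 : 0 < v - (s - y) := by linarith [hs.2]
    simp only [kernelA, wedge, gammaKernel, if_pos h1, if_pos h2, if_pos (And.intro hy hs.1)]
    rw [show -(y + v) = -s + -(v - (s - y)) by ring, Real.exp_add,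
      show v - (s - y) = y + v - s by ring]
    ring
  · simp only [kernelA, wedge, gammaKernel]
    split_ifs with h1 h2 h3 <;> simp
    exact absurd ⟨h1.2, by linarith⟩ hs

theorem integral_kernelB {a y v : ℝ} (hy : 0 < y) :
    ∫ s, kernelB a ((y, v), s) =
      Real.exp (-(y + v)) * ∫ s in y..max y v, (s - y) ^ a * (v - s) ^ a := by
  refine integral_ite_Ioo (le_max_left _ _) _ (fun s hs => ?_) fun s hs => ?_
  · have h1 : 0 < s - y := by linarith [hs.1]
    have h2 : 0 < v - s := by
      rcases lt_max_iff.1 hs.2 with h | h <;> linarith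
    simp only [kernelB, gammaKernel, if_pos h1, if_pos h2, if_pos hy]
    rw [show -(y + v) = -(2 * y) + (-(s - y) + -(v - s)) by ring, Real.exp_add, Real.exp_add]
    ring
  · simp only [kernelB, gammaKernel]
    split_ifs with h2 h3 <;> simp
    exact absurd ⟨by linarith, lt_max_of_lt_right (by linarith)⟩ hs

theorem abs_sub_lt_and_lt_add_iff {y v q : ℝ} :
    |q - y| < v ∧ v < y + q ↔ q ∈ Ioo |v - y| (y + v) := by
  rw [mem_Ioo, abs_lt, abs_lt]
  constructor <;> rintro ⟨h1, h2⟩ <;> refine ⟨⟨?_, ?_⟩, ?_⟩ <;> linarith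

theorem integral_kernelD {a y v : ℝ} (hy : 0 < y) (hv : 0 < v) :
    ∫ q, kernelD a ((y, v), q) =
      Real.exp (-(y + v)) * ∫ q in |v - y|..(y + v), q ^ (2 * a) := by
  refine integral_ite_Ioo (by rw [abs_le]; constructor <;> linarith) _ (fun q hq => ?_)
    fun q hq => ?_
  · exact if_pos ⟨hy, abs_sub_lt_and_lt_add_iff.2 hq⟩
  · exact if_neg fun h => hq (abs_sub_lt_and_lt_add_iff.1 h.2)

theorem measurable_realSign : Measurable Real.sign :=
  Measurable.ite measurableSet_Iio measurable_const
    (Measurable.ite measurableSet_Ioi measurable_const measurable_const)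

theorem measurable_phiIntegrand (a : ℝ) :
    Measurable fun p : (ℝ × ℝ) × ℝ => phiIntegrand a p.1.1 p.1.2 p.2 := by
  unfold phiIntegrand
  have h1 : Measurable fun p : (ℝ × ℝ) × ℝ => Real.sign (p.1.1 + p.1.2 - p.2) :=
    measurable_realSign.comp (by fun_prop)
  have h2 : Measurable fun p : (ℝ × ℝ) × ℝ => Real.sign (p.1.2 - p.2) :=
    measurable_realSign.comp (by fun_prop)
  fun_prop

/-- The rescaled integrand `e^{-(y+v)} Φ_S(y, v)` restricted to the square `(0, S]²`. -/
noncomputable def scaledIntegrand (a S : ℝ) : ℝ × ℝ → ℝ :=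
  (Ioc 0 S ×ˢ Ioc 0 S).indicator fun p =>
    Real.exp (-(p.1 + p.2)) * ∫ s in p.1..S, phiIntegrand a p.1 p.2 s

theorem stronglyMeasurable_scaledIntegrand (a S : ℝ) :
    StronglyMeasurable (scaledIntegrand a S) := by
  have e : scaledIntegrand a S = (Ioc 0 S ×ˢ Ioc 0 S).indicator fun p =>
      Real.exp (-(p.1 + p.2)) *
        ∫ s, if p.1 < s ∧ s ≤ S then phiIntegrand a p.1 p.2 s else 0 := by
    refine indicator_congr fun p hp => ?_
    rw [intervalIntegral.integral_of_le hp.1.2, ← integral_indicator measurableSet_Ioc]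
    simp only [indicator, mem_Ioc]
  rw [e]
  refine StronglyMeasurable.indicator ?_ (measurableSet_Ioc.prod measurableSet_Ioc)
  refine (Measurable.stronglyMeasurable (by fun_prop)).mul ?_
  refine StronglyMeasurable.integral_prod_right' (f := fun p : (ℝ × ℝ) × ℝ =>
    if p.1.1 < p.2 ∧ p.2 ≤ S then phiIntegrand a p.1.1 p.1.2 p.2 else 0) ?_
  refine (Measurable.ite (MeasurableSet.inter (s₁ := {p : (ℝ × ℝ) × ℝ | p.1.1 < p.2})
    (s₂ := {p | p.2 ≤ S}) ?_ ?_) (measurable_phiIntegrand a) measurable_const).stronglyMeasurable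
  · exact measurableSet_lt (by fun_prop) (by fun_prop)
  · exact measurableSet_le (by fun_prop) (by fun_prop)

theorem integrable_rpow_mul_exp_half {a : ℝ} (ha : -1 < a) :
    Integrable ((Ioi 0).indicator fun x : ℝ => x ^ a * Real.exp (-(1 / 2) * x)) := by
  rw [integrable_indicator_iff measurableSet_Ioi]
  simpa using integrableOn_rpow_mul_exp_neg_mul_rpow (p := 1) (s := a) (b := 1 / 2) ha one_pos
    (by norm_num)

theorem integrable_abs_rpow_mul_exp_half {a : ℝ} (ha : -1 < a) (ha' : a < 0) :
    Integrable fun x : ℝ => |x| ^ a * Real.exp (-(1 / 2) * |x|) := by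
  have h := integrable_rpow_mul_exp_half ha
  refine (h.add h.comp_neg).congr (ae_of_all _ fun x => ?_)
  rcases lt_trichotomy x 0 with hx | rfl | hx
  · simp [indicator, hx, hx.not_gt, abs_of_neg hx]
  · simp [Real.zero_rpow ha'.ne]
  · simp [indicator, hx, hx.not_gt, abs_of_pos hx]

theorem integrable_diagonal_bound {a : ℝ} (ha : -1 < a) (ha' : a < 0) :
    Integrable fun p : ℝ × ℝ =>
      (Ioi 0).indicator (fun x : ℝ => x ^ (a + 1) * Real.exp (-(1 / 2) * x)) p.1 *
        (|p.2 - p.1| ^ a * Real.exp (-(1 / 2) * |p.2 - p.1|)) :=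
  ((integrable_rpow_mul_exp_half (a := a + 1) (by linarith)).convolution_integrand
    (ContinuousLinearMap.mul ℝ ℝ) (integrable_abs_rpow_mul_exp_half ha ha')).swap

theorem ae_fst_ne_snd : ∀ᵐ p : ℝ × ℝ, p.1 ≠ p.2 := by
  rw [Measure.volume_eq_prod, Measure.ae_prod_iff_ae_ae]
  · refine ae_of_all _ fun y => ?_
    filter_upwards [compl_mem_ae_iff.2 (measure_singleton (μ := volume) y)] with v hv
    exact fun h => hv h.symm
  · exact (measurableSet_eq_fun measurable_fst measurable_snd).compl

theorem exists_bound_and_tendsto_scaledIntegrand {a : ℝ} (ha : -1 < a) (ha' : a < 0) :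
    (∃ b : ℝ × ℝ → ℝ, Integrable b ∧ ∀ S, ∀ᵐ p, ‖scaledIntegrand a S p‖ ≤ b p) ∧
    Tendsto (fun S => ∫ p, scaledIntegrand a S p) atTop
      (𝓝 (Real.Gamma (a + 1) * Real.Gamma (a + 2) - 1 / 2 * Real.Gamma (a + 1) ^ 2 +
        -a * (Real.Gamma (a + 1) * Real.Gamma (-2 * a) / Real.Gamma (1 - a)) *
          Real.Gamma (2 * a + 2))) := by
  set C := -a * (Real.Gamma (a + 1) * Real.Gamma (-2 * a) / Real.Gamma (1 - a)) with hC
  have hG : ∀ {x : ℝ}, 0 < x → 0 ≤ Real.Gamma x := fun h => (Real.Gamma_pos_of_pos h).le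
  obtain ⟨iA, eA⟩ := integrable_integral_of_lintegral_eq (measurable_kernelA a)
    (kernelA_nonneg a) (mul_nonneg (hG (by linarith)) (hG (by linarith))) (lintegral_kernelA ha)
  obtain ⟨iB, eB⟩ := integrable_integral_of_lintegral_eq (measurable_kernelB a)
    (kernelB_nonneg a) (by positivity) (lintegral_kernelB ha)
  obtain ⟨iD, eD⟩ := integrable_integral_of_lintegral_eq (measurable_kernelD a)
    (kernelD_nonneg a) (hG (by linarith)) (lintegral_kernelD ha)
  have iE := (integrable_diagonal_bound ha ha').div_const (a + 1)
  have key : ∀ {y v : ℝ}, 0 < y → 0 < v → y ≠ v → Real.exp (-(y + v)) *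
      (∫ r in Ioi 0, r ^ a * ((r + |v - y|) ^ a - (r + (y + v)) ^ a)) =
        C * ∫ q, kernelD a ((y, v), q) := by
    intro y v hy hv hne
    rw [(integral_rpow_mul_sub_rpow ha ha' (abs_pos.2 (sub_ne_zero.2 hne.symm))
      (by rw [abs_le]; constructor <;> linarith)).2, integral_kernelD hy hv, ← hC]
    ring
  let b : ℝ × ℝ → ℝ := fun p => (∫ s, kernelA a (p, s)) + (∫ s, kernelB a (p, s)) +
    C * (∫ s, kernelD a (p, s)) +
    (Ioi 0).indicator (fun x : ℝ => x ^ (a + 1) * Real.exp (-(1 / 2) * x)) p.1 *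
        (|p.2 - p.1| ^ a * Real.exp (-(1 / 2) * |p.2 - p.1|)) / (a + 1)
  have hC0 : 0 ≤ C := mul_nonneg (by linarith) (div_nonneg (mul_nonneg (hG (by linarith))
    (hG (by linarith))) (hG (by linarith)))
  have ib : Integrable b := ((iA.add iB).add (iD.const_mul C)).add iE
  have hb : ∀ S, ∀ᵐ p, ‖scaledIntegrand a S p‖ ≤ b p := by
    intro S
    filter_upwards [ae_fst_ne_snd] with p hne
    obtain ⟨y, v⟩ := p
    by_cases hp : (y, v) ∈ Ioc 0 S ×ˢ Ioc 0 S
    · have hy : 0 < y := hp.1.1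
      have hv : 0 < v := hp.2.1
      rw [scaledIntegrand, indicator_of_mem hp, norm_mul, Real.norm_eq_abs, Real.norm_eq_abs,
        abs_of_pos (Real.exp_pos _)]
      refine (mul_le_mul_of_nonneg_left (abs_integral_phiIntegrand_le ha ha' hy hv hne hp.1.2
        hp.2.2) (Real.exp_pos _).le).trans ?_
      simp only [b]
      rw [integral_kernelA hy hv, integral_kernelB hy, ← key hy hv hne,
        indicator_of_mem (by exact hy), mul_add, mul_add, mul_add]
      refine add_le_add le_rfl ?_
      have h1 : Real.exp (-(y + v)) ≤ Real.exp (-(1 / 2) * y) * Real.exp (-(1 / 2) * |v - y|) := by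
        rw [← Real.exp_add, Real.exp_le_exp]
        have : |v - y| ≤ y + v := by rw [abs_le]; constructor <;> linarith
        linarith
      have h2 : 0 ≤ |v - y| ^ a * (y ^ (a + 1) / (a + 1)) := by
        have : 0 < a + 1 := by linarith
        positivity
      refine (mul_le_mul_of_nonneg_right h1 h2).trans (le_of_eq ?_)
      ring
    · rw [scaledIntegrand, indicator_of_notMem hp, norm_zero]
      have : 0 ≤ (Ioi 0).indicator (fun x : ℝ => x ^ (a + 1) * Real.exp (-(1 / 2) * x)) y :=
        indicator_nonneg (fun x hx => mul_nonneg (Real.rpow_nonneg (le_of_lt hx) _)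
          (Real.exp_pos _).le) _
      have h1 : 0 ≤ ∫ s, kernelA a ((y, v), s) := integral_nonneg fun s => kernelA_nonneg a _
      have h2 : 0 ≤ ∫ s, kernelB a ((y, v), s) := integral_nonneg fun s => kernelB_nonneg a _
      have h3 : 0 ≤ ∫ s, kernelD a ((y, v), s) := integral_nonneg fun s => kernelD_nonneg a _
      have h4 : 0 < a + 1 := by linarith
      simp only [b]
      positivity
  refine ⟨⟨b, ib, hb⟩, ?_⟩
  have e : Real.Gamma (a + 1) * Real.Gamma (a + 2) - 1 / 2 * Real.Gamma (a + 1) ^ 2 +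
      C * Real.Gamma (2 * a + 2) = ∫ p : ℝ × ℝ, ((∫ s, kernelA a (p, s)) -
        (∫ s, kernelB a (p, s)) + C * (∫ s, kernelD a (p, s))) := by
    rw [integral_add (by exact iA.sub iB) (iD.const_mul C), integral_sub iA iB,
      integral_const_mul, eA, eB, eD]
  rw [e]
  refine tendsto_integral_filter_of_dominated_convergence b
    (Eventually.of_forall fun S => (stronglyMeasurable_scaledIntegrand a S).aestronglyMeasurable)
    (Eventually.of_forall hb) ib ?_
  filter_upwards [ae_fst_ne_snd] with p hne
  obtain ⟨y, v⟩ := p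
  by_cases hp : 0 < y ∧ 0 < v
  · obtain ⟨hy, hv⟩ := hp
    rw [integral_kernelA hy hv, integral_kernelB hy, ← key hy hv hne, ← mul_sub, ← mul_add]
    refine ((tendsto_integral_phiIntegrand ha ha' hy hv hne).const_mul _).congr' ?_
    filter_upwards [eventually_ge_atTop y, eventually_ge_atTop v] with S h1 h2
    rw [scaledIntegrand, indicator_of_mem (by exact ⟨⟨hy, h1⟩, ⟨hv, h2⟩⟩)]
  · simp only [kernelA_eq_zero hp, kernelB_eq_zero hp, kernelD_eq_zero hp, integral_zero]
    have : ∀ S, scaledIntegrand a S (y, v) = 0 := fun S =>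
      indicator_of_notMem (fun h => hp ⟨h.1.1, h.2.1⟩) _
    simp [this]

theorem integral_scaledIntegrand {a S : ℝ} (ha : -1 < a) (ha' : a < 0) (hS : 0 ≤ S) :
    ∫ p, scaledIntegrand a S p = ∫ y in 0..S, ∫ v in 0..S,
      Real.exp (-(y + v)) * ∫ s in y..S, phiIntegrand a y v s := by
  obtain ⟨b, ib, hb⟩ := (exists_bound_and_tendsto_scaledIntegrand ha ha').1
  have hm := measurableSet_Ioc (a := (0 : ℝ)) (b := S) |>.prod
    (measurableSet_Ioc (a := (0 : ℝ)) (b := S))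
  have hi : Integrable (scaledIntegrand a S) :=
    ib.mono' (stronglyMeasurable_scaledIntegrand a S).aestronglyMeasurable (hb S)
  rw [scaledIntegrand, integrable_indicator_iff hm] at hi
  rw [scaledIntegrand, integral_indicator hm, Measure.volume_eq_prod, setIntegral_prod _ hi,
    intervalIntegral.integral_of_le hS]
  simp_rw [intervalIntegral.integral_of_le hS]

theorem phiIntegrand_mul {a R x u t : ℝ} (hR : 0 < R) (hx : 0 ≤ x) (ht : x ≤ t) :
    phiIntegrand a (R * x) (R * u) (R * t) = R ^ (2 * a) * phiIntegrand a x u t := by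
  have hs : ∀ z, Real.sign (R * z) = Real.sign z := fun z => by
    rcases lt_trichotomy z 0 with h | rfl | h
    · rw [Real.sign_of_neg h, Real.sign_of_neg (mul_neg_of_pos_of_neg hR h)]
    · simp
    · rw [Real.sign_of_pos h, Real.sign_of_pos (mul_pos hR h)]
  have hr : R ^ (2 * a) = R ^ a * R ^ a := by rw [two_mul, Real.rpow_add hR]
  simp only [phiIntegrand, ← mul_add, ← mul_sub, abs_mul, hs, abs_of_pos hR]
  rw [Real.mul_rpow hR.le (hx.trans ht), Real.mul_rpow hR.le (abs_nonneg _),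
    Real.mul_rpow hR.le (abs_nonneg _), Real.mul_rpow hR.le (sub_nonneg.2 ht), hr]
  ring

theorem integral_phiIntegrand_scale {a R : ℝ} (hR : 0 < R) :
    ∫ y in 0..R, ∫ v in 0..R, Real.exp (-(y + v)) * ∫ s in y..R, phiIntegrand a y v s =
      R ^ (2 * a + 3) * ∫ x in (0 : ℝ)..1, ∫ u in (0 : ℝ)..1,
        Real.exp (-(R * (u + x))) * ∫ t in x..1, phiIntegrand a x u t := by
  have h : ∀ f : ℝ → ℝ, ∫ y in 0..R, f y = R * ∫ x in (0 : ℝ)..1, f (R * x) := by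
    intro f
    rw [intervalIntegral.mul_integral_comp_mul_left, mul_zero, mul_one]
  rw [h, ← intervalIntegral.integral_const_mul, ← intervalIntegral.integral_const_mul]
  refine intervalIntegral.integral_congr fun x hx => ?_
  rw [uIcc_of_le zero_le_one] at hx
  rw [h, ← mul_assoc, ← intervalIntegral.integral_const_mul, ← intervalIntegral.integral_const_mul]
  refine intervalIntegral.integral_congr fun u _ => ?_
  have e : ∫ s in R * x..R, phiIntegrand a (R * x) (R * u) s =
      R * (R ^ (2 * a) * ∫ t in x..1, phiIntegrand a x u t) := by
    have := intervalIntegral.mul_integral_comp_mul_left (a := x) (b := 1)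
      (f := phiIntegrand a (R * x) (R * u)) (c := R)
    rw [mul_one] at this
    rw [← this, ← intervalIntegral.integral_const_mul (R ^ (2 * a))]
    congr 1
    refine intervalIntegral.integral_congr fun t ht => ?_
    rw [uIcc_of_le hx.2] at ht
    exact phiIntegrand_mul hR hx.1 ht.1
  rw [e, show R ^ (2 * a + 3) = R ^ (2 * a) * R ^ 3 by
    rw [Real.rpow_add hR]; norm_cast, show -(R * x + R * u) = -(R * (u + x)) by ring]
  ring

/-- The nonvanishing term: `lim_{T→∞} ∫_{[0,1]²} ψ(x,u) φ₄(x,u) dx du`. -/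
theorem limit_psi_phi4 (H θ : ℝ) (hH : H ∈ Set.Ioo (0:ℝ) (1/2)) (hθ : 0 < θ) :
    Filter.Tendsto (fun T : ℝ =>
      ∫ x in (0:ℝ)..1, ∫ u in (0:ℝ)..1,
        (T ^ (4*H + 1) * Real.exp (-θ * T * (u + x))) *
          ∫ t in x..1,
            (t ^ (2*H - 1) * Real.sign (x + u - t) * |x + u - t| ^ (2*H - 1)
              - (t - x) ^ (2*H - 1) * Real.sign (u - t) * |u - t| ^ (2*H - 1)))
      Filter.atTop
      (nhds (θ ^ (-1 - 4*H) * (Real.Gamma (2*H) ^ 2 * (2*H - 1/2)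
        + Real.Gamma (2 - 4*H) * Real.Gamma (2*H) * Real.Gamma (4*H)
          / Real.Gamma (1 - 2*H)))) := by
  obtain ⟨h0, h1⟩ := hH
  have ha : -1 < 2 * H - 1 := by linarith
  have ha' : 2 * H - 1 < 0 := by linarith
  have hT : Tendsto (fun T => θ * T) atTop atTop := tendsto_id.const_mul_atTop hθ
  have key := (((exists_bound_and_tendsto_scaledIntegrand ha ha').2.comp hT).const_mul
    (θ ^ (-1 - 4 * H)))
  convert key.congr' ?_ using 2
  · have hg : Real.Gamma (1 - (2 * H - 1)) = (1 - 2 * H) * Real.Gamma (1 - 2 * H) := by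
      rw [← Real.Gamma_add_one (by linarith)]; ring_nf
    have hg2 : Real.Gamma (2 * H - 1 + 2) = 2 * H * Real.Gamma (2 * H) := by
      rw [← Real.Gamma_add_one (by linarith)]; ring_nf
    rw [hg, hg2, show 2 * H - 1 + 1 = 2 * H by ring, show -2 * (2 * H - 1) = 2 - 4 * H by ring,
      show 2 * (2 * H - 1) + 2 = 4 * H by ring]
    have hp : Real.Gamma (1 - 2 * H) ≠ 0 := (Real.Gamma_pos_of_pos (by linarith)).ne'
    have hp2 : 1 - 2 * H ≠ 0 := by linarith
    congr 1
    field_simp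
    ring
  · filter_upwards [eventually_gt_atTop 0] with T hT0
    have hR : 0 < θ * T := mul_pos hθ hT0
    rw [Function.comp_apply, integral_scaledIntegrand ha ha' hR.le,
      integral_phiIntegrand_scale hR, ← mul_assoc]
    have e : θ ^ (-1 - 4 * H) * (θ * T) ^ (2 * (2 * H - 1) + 3) = T ^ (4 * H + 1) := by
      rw [show 2 * (2 * H - 1) + 3 = 4 * H + 1 by ring, Real.mul_rpow hθ.le hT0.le, ← mul_assoc,
        ← Real.rpow_add hθ, show -1 - 4 * H + (4 * H + 1) = 0 by ring, Real.rpow_zero, one_mul]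
    rw [e, ← intervalIntegral.integral_const_mul]
    refine intervalIntegral.integral_congr fun x _ => ?_
    rw [← intervalIntegral.integral_const_mul]
    refine intervalIntegral.integral_congr fun u _ => ?_
    simp only [phiIntegrand]
    rw [show -θ * T * (u + x) = -(θ * T * (u + x)) by ring]
    exact (mul_assoc _ _ _).symm
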